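/- There exists a constant C > 0 such that for every k_F ≥ 1, every β ≥ 0, and every function f : ℤ³ → [0, ∞), one has Σ_{k ∈ ℤ³} f(k) ⟨k⟩^{2β} D₁(k, k_F) ≤ C k_F Σ_{k ∈ ℤ³} f(k) ⟨k⟩^{2β + 4} (the inequality being trivially true when the right-hand side is infinite). In particular, taking f(k) = |V̂(k)|², one has S_{1,β}(k_F) ≤ C ‖V‖²_{H^{2+β}} k_F. -/

import Mathlib

open scoped BigOperators

/-- The Euclidean norm of a lattice point `k ∈ ℤ³`. -/
noncomputable def znorm (k : Fin 3 → ℤ) : ℝ := Real.sqrt (∑ i, ((k i : ℝ))^2)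

/-- The lune set `L(k) = {p ∈ ℤ³ : |p| > k_F and |p − k| ≤ k_F}`. -/
def lune (kF : ℝ) (k : Fin 3 → ℤ) : Set (Fin 3 → ℤ) :=
  {p | kF < znorm p ∧ znorm (p - k) ≤ kF}

/- The resolvent sum `D_α(k, k_F) = Σ_{p ∈ L(k)} (|p|² − |p − k|²)^{−α}`
(a finite sum, written as a `tsum` of the indicator; the power is a real power). -/
open Classical in
noncomputable def Dsum (α kF : ℝ) (k : Fin 3 → ℤ) : ℝ :=
  ∑' p : Fin 3 → ℤ,
    if p ∈ lune kF k then ((znorm p) ^ 2 - (znorm (p - k)) ^ 2) ^ (-α) else 0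

open scoped ENNReal

/-- The Japanese bracket `⟨k⟩ = (1 + |k|²)^{1/2}`. -/
noncomputable def jap (k : Fin 3 → ℤ) : ℝ := Real.sqrt (1 + (znorm k) ^ 2)

/-- `∑_{n < N} 1 / √(n + 1) ≤ 2 √N`. -/
lemma sum_inv_sqrt_succ_le (N : ℕ) :
    ∑ n ∈ Finset.range N, 1 / √((n : ℝ) + 1) ≤ 2 * √(N : ℝ) := by
  induction N with
  | zero => simp
  | succ N ih =>
    rw [Finset.sum_range_succ]
    have hpos : 0 < √((N : ℝ) + 1) := Real.sqrt_pos.mpr (by positivity)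
    have hs : √((N : ℝ) + 1) ^ 2 = N + 1 := Real.sq_sqrt (by positivity)
    have ht : √(N : ℝ) ^ 2 = N := Real.sq_sqrt (by positivity)
    have hstep : 1 / √((N : ℝ) + 1) ≤ 2 * √((N : ℝ) + 1) - 2 * √(N : ℝ) := by
      rw [div_le_iff₀ hpos]
      nlinarith [sq_nonneg (√((N : ℝ) + 1) - √(N : ℝ))]
    push_cast
    linarith

lemma sum_range_inv_one_add_sqrt_le {L : ℝ} (hL : 0 ≤ L) :
    ∑ n ∈ Finset.range (⌊L⌋₊ + 1), 1 / (1 + √(L * (n : ℝ))) ≤ 3 := by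
  rw [Finset.sum_range_succ']
  have hterm : ∀ n ∈ Finset.range ⌊L⌋₊, 1 / (1 + √(L * ((n + 1 : ℕ) : ℝ))) ≤
      1 / √(⌊L⌋₊ : ℝ) * (1 / √((n : ℝ) + 1)) := by
    intro n hn
    have hN : 0 < ⌊L⌋₊ := lt_of_le_of_lt (Nat.zero_le n) (Finset.mem_range.mp hn)
    have hN' : (0 : ℝ) < ⌊L⌋₊ := by exact_mod_cast hN
    rw [one_div_mul_one_div, ← Real.sqrt_mul hN'.le]
    apply one_div_le_one_div_of_le (Real.sqrt_pos.mpr (by positivity))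
    have : √((⌊L⌋₊ : ℝ) * (n + 1)) ≤ √(L * ((n + 1 : ℕ) : ℝ)) := by
      push_cast
      have := Nat.floor_le hL
      gcongr
    linarith
  have hsum := Finset.sum_le_sum hterm
  rw [← Finset.mul_sum] at hsum
  have hle : 1 / √(⌊L⌋₊ : ℝ) * ∑ n ∈ Finset.range ⌊L⌋₊, 1 / √((n : ℝ) + 1) ≤ 2 := by
    rcases Nat.eq_zero_or_pos ⌊L⌋₊ with h0 | h0
    · simp [h0]
    · have hpos : 0 < √(⌊L⌋₊ : ℝ) := Real.sqrt_pos.mpr (by exact_mod_cast h0)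
      rw [one_div_mul_eq_div, div_le_iff₀ hpos]
      exact sum_inv_sqrt_succ_le _
  have h0 : 1 / (1 + √(L * ((0 : ℕ) : ℝ))) = 1 := by simp
  rw [h0]
  linarith

lemma sum_inv_one_add_sqrt_sub_le {L a : ℝ} (T : Finset ℤ)
    (hT : ∀ x ∈ T, 0 ≤ a - x ∧ a - x ≤ L) :
    ∑ x ∈ T, 1 / (1 + √(L * (a - x))) ≤ 3 := by
  rcases T.eq_empty_or_nonempty with rfl | ⟨x₀, hx₀⟩
  · simp
  have hL : 0 ≤ L := (hT x₀ hx₀).1.trans (hT x₀ hx₀).2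
  have hfloor : ∀ x ∈ T, x ≤ ⌊a⌋ := fun x hx => Int.le_floor.mpr (by linarith [(hT x hx).1])
  have hcast : ∀ x ∈ T, (((⌊a⌋ - x).toNat : ℕ) : ℝ) = (⌊a⌋ : ℝ) - x := by
    intro x hx
    have : (((⌊a⌋ - x).toNat : ℕ) : ℤ) = ⌊a⌋ - x :=
      Int.toNat_of_nonneg (by linarith [hfloor x hx])
    exact_mod_cast this
  have hinj : Set.InjOn (fun x : ℤ => (⌊a⌋ - x).toNat) T := by
    intro x hx y hy hxy
    have h1 := hfloor x hx
    have h2 := hfloor y hy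
    simp only at hxy
    omega
  calc ∑ x ∈ T, 1 / (1 + √(L * (a - x)))
      ≤ ∑ x ∈ T, 1 / (1 + √(L * (((⌊a⌋ - x).toNat : ℕ) : ℝ))) := by
        refine Finset.sum_le_sum fun x hx => ?_
        rw [hcast x hx]
        have := Int.floor_le a
        gcongr
    _ = ∑ n ∈ T.image fun x : ℤ => (⌊a⌋ - x).toNat, 1 / (1 + √(L * (n : ℝ))) :=
        (Finset.sum_image (f := fun n : ℕ => 1 / (1 + √(L * (n : ℝ)))) hinj).symm
    _ ≤ ∑ n ∈ Finset.range (⌊L⌋₊ + 1), 1 / (1 + √(L * (n : ℝ))) := by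
        refine Finset.sum_le_sum_of_subset_of_nonneg ?_ fun _ _ _ => by positivity
        intro n hn
        obtain ⟨x, hx, rfl⟩ := Finset.mem_image.mp hn
        rw [Finset.mem_range, Nat.lt_succ_iff]
        apply Nat.le_floor
        rw [hcast x hx]
        linarith [Int.floor_le a, (hT x hx).2]
    _ ≤ 3 := sum_range_inv_one_add_sqrt_le hL

/-- The values of `1 / (1 + √(h - A (x - c)²))` at the integers where the radicand is nonnegative
have a sum bounded uniformly in `h`, `c` and `A ≥ 1`. -/
lemma sum_inv_one_add_sqrt_quadratic_le {A c h : ℝ} (hA : 1 ≤ A) (T : Finset ℤ)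
    (hT : ∀ x ∈ T, A * ((x : ℝ) - c) ^ 2 ≤ h) :
    ∑ x ∈ T, 1 / (1 + √(h - A * ((x : ℝ) - c) ^ 2)) ≤ 6 := by
  set L := √(h / A) with hLdef
  have hL0 : 0 ≤ L := Real.sqrt_nonneg _
  have habs : ∀ x ∈ T, |(x : ℝ) - c| ≤ L := by
    intro x hx
    apply Real.abs_le_sqrt
    rw [le_div_iff₀ (by linarith)]
    linarith [hT x hx]
  have hL2 : ∀ x ∈ T, h = A * L ^ 2 := by
    intro x hx
    have : 0 ≤ h := le_trans (by positivity) (hT x hx)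
    rw [hLdef, Real.sq_sqrt (by positivity)]
    field_simp
  have hterm : ∀ x ∈ T, 1 / (1 + √(h - A * ((x : ℝ) - c) ^ 2)) ≤
      1 / (1 + √(L * (L - |(x : ℝ) - c|))) := by
    intro x hx
    have h1 := habs x hx
    have h2 := abs_nonneg ((x : ℝ) - c)
    have h3 : L * (L - |(x : ℝ) - c|) ≤ h - A * ((x : ℝ) - c) ^ 2 := by
      rw [hL2 x hx, ← sq_abs ((x : ℝ) - c)]
      nlinarith [mul_nonneg (sub_nonneg.mpr h1) h2,
        mul_nonneg (sub_nonneg.mpr hA) (mul_nonneg (sub_nonneg.mpr h1) (add_nonneg hL0 h2))]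
    gcongr
  refine (Finset.sum_le_sum hterm).trans ?_
  rw [← Finset.sum_filter_add_sum_filter_not T fun x : ℤ => c ≤ (x : ℝ)]
  have hright : ∑ x ∈ T with c ≤ ((x : ℤ) : ℝ), 1 / (1 + √(L * (L - |(x : ℝ) - c|))) ≤ 3 := by
    refine le_of_eq_of_le (Finset.sum_congr rfl fun x hx => ?_)
      (sum_inv_one_add_sqrt_sub_le (L := L) (a := c + L) _ fun x hx => ?_)
    · rw [abs_of_nonneg (by linarith [(Finset.mem_filter.mp hx).2])]
      ring_nf
    · obtain ⟨hxT, hx⟩ := Finset.mem_filter.mp hx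
      have := (abs_le.mp (habs x hxT)).2
      constructor <;> linarith
  have hleft : ∑ x ∈ T with ¬ c ≤ ((x : ℤ) : ℝ), 1 / (1 + √(L * (L - |(x : ℝ) - c|))) ≤ 3 := by
    have key := sum_inv_one_add_sqrt_sub_le (L := L) (a := L - c)
      ((T.filter fun x : ℤ => ¬ c ≤ (x : ℝ)).image Neg.neg) ?_
    · rw [Finset.sum_image neg_injective.injOn] at key
      refine le_of_eq_of_le (Finset.sum_congr rfl fun x hx => ?_) key
      rw [abs_of_nonpos (by linarith [(Finset.mem_filter.mp hx).2])]
      push_cast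
      ring_nf
    · intro y hy
      obtain ⟨x, hx, rfl⟩ := Finset.mem_image.mp hy
      obtain ⟨hxT, hx⟩ := Finset.mem_filter.mp hx
      have := (abs_le.mp (habs x hxT)).1
      push_cast
      constructor <;> linarith
  linarith

lemma sum_fin_three_cyclic {M : Type*} [AddCommMonoid M] (i : Fin 3) (g : Fin 3 → M) :
    ∑ j, g j = g i + g (i + 1) + g (i + 2) := by
  rw [← Equiv.sum_comp (Equiv.addLeft i) g, Fin.sum_univ_three]
  simp

lemma znorm_sq (p : Fin 3 → ℤ) : znorm p ^ 2 = ∑ i, (p i : ℝ) ^ 2 :=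
  Real.sq_sqrt (Finset.sum_nonneg fun _ _ => sq_nonneg _)

lemma znorm_nonneg (p : Fin 3 → ℤ) : 0 ≤ znorm p := Real.sqrt_nonneg _

/-- The integer `p · k`. -/
def zdot (p k : Fin 3 → ℤ) : ℤ := ∑ i, p i * k i

lemma znorm_add_smul_sq (p k : Fin 3 → ℤ) (t : ℤ) :
    znorm (p + t • k) ^ 2 = znorm p ^ 2 + 2 * t * zdot p k + t ^ 2 * znorm k ^ 2 := by
  simp only [znorm_sq, zdot, Fin.sum_univ_three, Pi.add_apply, Pi.smul_apply, smul_eq_mul]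
  push_cast
  ring

lemma znorm_sub_sq (p k : Fin 3 → ℤ) :
    znorm (p - k) ^ 2 = znorm p ^ 2 - 2 * zdot p k + znorm k ^ 2 := by
  have := znorm_add_smul_sq p k (-1)
  rw [neg_one_smul, ← sub_eq_add_neg] at this
  rw [this]
  push_cast
  ring

lemma mem_lune_sq {kF : ℝ} (hkF : 0 ≤ kF) {k p : Fin 3 → ℤ} (hp : p ∈ lune kF k) :
    kF ^ 2 < znorm p ^ 2 ∧ znorm p ^ 2 - 2 * zdot p k + znorm k ^ 2 ≤ kF ^ 2 := by
  rw [← znorm_sub_sq]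
  have := znorm_nonneg (p - k)
  exact ⟨by nlinarith [hp.1], by nlinarith [hp.2]⟩

/-- Each line in direction `k` meets the lune at most once. -/
lemma eq_zero_of_mem_lune_of_add_smul_mem_lune {kF : ℝ} (hkF : 0 ≤ kF) {k p : Fin 3 → ℤ} {t : ℤ}
    (hp : p ∈ lune kF k) (hq : p + t • k ∈ lune kF k) : t = 0 := by
  have nonpos : ∀ (p : Fin 3 → ℤ) (t : ℤ), p ∈ lune kF k → p + t • k ∈ lune kF k → t ≤ 0 := by
    intro p t hp hq
    by_contra! ht
    obtain ⟨h1, h2⟩ := mem_lune_sq hkF hp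
    have h3 := (mem_lune_sq hkF hq).2
    rw [← znorm_sub_sq] at h3
    have heq : p + t • k - k = p + (t - 1) • k := by rw [sub_smul, one_smul]; abel
    rw [heq, znorm_add_smul_sq] at h3
    have ht' : (0 : ℝ) ≤ ((t - 1 : ℤ) : ℝ) := by exact_mod_cast (by omega)
    have hdot : (0 : ℝ) ≤ zdot p k := by nlinarith [sq_nonneg (znorm k)]
    nlinarith [mul_nonneg ht' hdot, mul_nonneg (sq_nonneg ((t - 1 : ℤ) : ℝ)) (sq_nonneg (znorm k))]
  refine le_antisymm (nonpos p t hp hq) ?_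
  have := nonpos (p + t • k) (-t) hq (by simpa using hp)
  omega

/-- The squared length of the cross product `p × k`. -/
noncomputable def crossSq (p k : Fin 3 → ℤ) : ℝ :=
  znorm k ^ 2 * znorm p ^ 2 - (zdot p k : ℝ) ^ 2

lemma crossSq_eq (i : Fin 3) (p k : Fin 3 → ℤ) :
    crossSq p k = ((p (i + 2) * k i - p i * k (i + 2) : ℤ) : ℝ) ^ 2 +
      ((p i : ℝ) * k (i + 1) - p (i + 1) * k i) ^ 2 +
      ((p (i + 1) : ℝ) * k (i + 2) - p (i + 2) * k (i + 1)) ^ 2 := by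
  rw [crossSq, znorm_sq, znorm_sq, zdot, sum_fin_three_cyclic i, sum_fin_three_cyclic i,
    sum_fin_three_cyclic i]
  push_cast
  ring

lemma crossSq_le_of_mem_lune {kF : ℝ} (hkF : 0 ≤ kF) {k p : Fin 3 → ℤ} (hp : p ∈ lune kF k) :
    crossSq p k ≤ (znorm k * kF) ^ 2 := by
  have h2 := (mem_lune_sq hkF hp).2
  have := mul_le_mul_of_nonneg_left h2 (sq_nonneg (znorm k))
  rw [crossSq]
  nlinarith [sq_nonneg ((zdot p k : ℝ) - znorm k ^ 2)]

lemma inv_gap_le_of_mem_lune {kF : ℝ} (hkF : 0 ≤ kF) {k p : Fin 3 → ℤ} (hp : p ∈ lune kF k) :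
    (znorm p ^ 2 - znorm (p - k) ^ 2) ^ (-(1 : ℝ)) ≤
      (1 + znorm k ^ 2) * (1 / (1 + √((znorm k * kF) ^ 2 - crossSq p k))) := by
  obtain ⟨h1, h2⟩ := mem_lune_sq hkF hp
  have hgap : znorm p ^ 2 - znorm (p - k) ^ 2 = 2 * zdot p k - znorm k ^ 2 := by
    rw [znorm_sub_sq]; ring
  have hk0 : 0 ≤ znorm k ^ 2 := sq_nonneg _
  have hm : (1 : ℝ) ≤ 2 * zdot p k - znorm k ^ 2 := by
    have hint : (2 * zdot p k - znorm k ^ 2 : ℝ) = ((2 * zdot p k - ∑ i, k i ^ 2 : ℤ) : ℝ) := by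
      rw [znorm_sq]; push_cast; ring
    have : (0 : ℝ) < 2 * zdot p k - znorm k ^ 2 := by linarith
    rw [hint] at this ⊢
    exact_mod_cast this
  have hs : (1 : ℝ) ≤ zdot p k := by
    have : (0 : ℝ) < zdot p k := by linarith
    exact_mod_cast this
  have hsqrt : √((znorm k * kF) ^ 2 - crossSq p k) ≤ zdot p k := by
    apply Real.sqrt_le_iff.mpr ⟨by linarith, ?_⟩
    rw [crossSq]
    nlinarith [mul_le_mul_of_nonneg_left h1.le hk0]
  rw [Real.rpow_neg_one, hgap, mul_one_div, inv_eq_one_div,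
    div_le_div_iff₀ (by linarith) (by positivity)]
  nlinarith [mul_nonneg hk0 (sub_nonneg.mpr hm)]

/-- The part of the resolvent sum over lattice points in a fixed coset of the plane spanned by
`k` and a basis vector, with one coordinate in a fixed residue class. -/
lemma sum_inv_gap_row_le {kF : ℝ} (hkF : 0 ≤ kF) {k : Fin 3 → ℤ} {i : Fin 3} (hi : k i ≠ 0)
    (w r : ℤ) (S : Finset (Fin 3 → ℤ))
    (hS : ∀ p ∈ S, p ∈ lune kF k ∧ p (i + 2) * k i - p i * k (i + 2) = w ∧ p i % k i = r) :
    ∑ p ∈ S, (znorm p ^ 2 - znorm (p - k) ^ 2) ^ (-(1 : ℝ)) ≤ (1 + znorm k ^ 2) * 6 := by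
  set X : (Fin 3 → ℤ) → ℤ := fun p => p (i + 1) - p i / k i * k (i + 1) with hX
  have hki : (k i : ℝ) ≠ 0 := by exact_mod_cast hi
  set y : ℝ := ((w : ℝ) + r * k (i + 2)) / k i with hy
  set A : ℝ := (k i : ℝ) ^ 2 + (k (i + 2) : ℝ) ^ 2 with hAdef
  set B : ℝ := r * k (i + 1) * k i + y * k (i + 1) * k (i + 2) with hBdef
  set D : ℝ := (w : ℝ) ^ 2 + (r * k (i + 1)) ^ 2 + (y * k (i + 1)) ^ 2 with hDdef
  have hA : 1 ≤ A := by
    have : (1 : ℤ) ≤ k i ^ 2 := by have := sq_pos_of_ne_zero hi; omega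
    have : (1 : ℝ) ≤ (k i : ℝ) ^ 2 := by exact_mod_cast this
    nlinarith [sq_nonneg (k (i + 2) : ℝ)]
  have hinj : Set.InjOn X S := by
    intro p hp q hq hpq
    obtain ⟨hpl, hpw, hpr⟩ := hS p hp
    obtain ⟨hql, hqw, hqr⟩ := hS q hq
    have e0 : q i = p i + (q i / k i - p i / k i) * k i := by
      have h1 := Int.mul_ediv_add_emod (p i) (k i)
      have h2 := Int.mul_ediv_add_emod (q i) (k i)
      rw [hpr] at h1
      rw [hqr] at h2
      linarith
    have e1 : q (i + 1) = p (i + 1) + (q i / k i - p i / k i) * k (i + 1) := by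
      simp only [hX] at hpq
      linarith
    have e2 : q (i + 2) = p (i + 2) + (q i / k i - p i / k i) * k (i + 2) := by
      apply mul_right_cancel₀ hi
      linear_combination hqw - hpw + k (i + 2) * e0
    have hline : q = p + (q i / k i - p i / k i) • k := by
      have hcover : ∀ i j : Fin 3, j = i ∨ j = i + 1 ∨ j = i + 2 := by decide
      funext j
      simp only [Pi.add_apply, Pi.smul_apply, smul_eq_mul]
      rcases hcover i j with rfl | rfl | rfl
      exacts [e0, e1, e2]
    have ht := eq_zero_of_mem_lune_of_add_smul_mem_lune hkF hpl (hline ▸ hql)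
    rw [ht, zero_smul, add_zero] at hline
    exact hline.symm
  have hcross : ∀ p ∈ S, (znorm k * kF) ^ 2 - crossSq p k =
      ((znorm k * kF) ^ 2 - D + B ^ 2 / A) - A * ((X p : ℝ) - B / A) ^ 2 := by
    intro p hp
    obtain ⟨-, hpw, hpr⟩ := hS p hp
    have h0 : (p i : ℝ) = r + k i * ((p i / k i : ℤ) : ℝ) := by
      have h1 := Int.mul_ediv_add_emod (p i) (k i)
      rw [hpr] at h1
      have : p i = r + k i * (p i / k i) := by linarith
      exact_mod_cast this
    have h1 : (p (i + 1) : ℝ) = X p + ((p i / k i : ℤ) : ℝ) * k (i + 1) := by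
      simp only [hX]
      push_cast
      ring
    have h2 : (p (i + 2) : ℝ) = y + ((p i / k i : ℤ) : ℝ) * k (i + 2) := by
      have hw : (p (i + 2) : ℝ) * k i - p i * k (i + 2) = w := by exact_mod_cast hpw
      rw [h0] at hw
      rw [hy]
      field_simp
      linear_combination hw
    have hA0 : A ≠ 0 := by linarith
    have hsq : A * ((X p : ℝ) - B / A) ^ 2 = A * (X p : ℝ) ^ 2 - 2 * B * X p + B ^ 2 / A := by
      field_simp
      ring
    rw [crossSq_eq i, hpw, hsq, h0, h1, h2, hAdef, hBdef, hDdef]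
    ring
  calc ∑ p ∈ S, (znorm p ^ 2 - znorm (p - k) ^ 2) ^ (-(1 : ℝ))
      ≤ ∑ p ∈ S, (1 + znorm k ^ 2) * (1 / (1 + √(((znorm k * kF) ^ 2 - D + B ^ 2 / A) -
          A * ((X p : ℝ) - B / A) ^ 2))) := by
        refine Finset.sum_le_sum fun p hp => ?_
        rw [← hcross p hp]
        exact inv_gap_le_of_mem_lune hkF (hS p hp).1
    _ = (1 + znorm k ^ 2) * ∑ x ∈ S.image X, 1 / (1 + √(((znorm k * kF) ^ 2 - D + B ^ 2 / A) -
          A * ((x : ℝ) - B / A) ^ 2)) := by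
        rw [Finset.sum_image hinj, Finset.mul_sum]
    _ ≤ (1 + znorm k ^ 2) * 6 := by
        refine mul_le_mul_of_nonneg_left
          (sum_inv_one_add_sqrt_quadratic_le hA _ fun x hx => ?_) (by positivity)
        obtain ⟨p, hp, rfl⟩ := Finset.mem_image.mp hx
        have := hcross p hp
        linarith [crossSq_le_of_mem_lune hkF (hS p hp).1]

lemma Dsum_zero (α kF : ℝ) : Dsum α kF 0 = 0 := by
  have : ∀ p, p ∉ lune kF 0 := fun p hp => absurd hp.2 (by simpa using hp.1)
  simp [Dsum, this]

lemma Dsum_one_le {kF : ℝ} (hkF : 1 ≤ kF) (k : Fin 3 → ℤ) :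
    Dsum 1 kF k ≤ 18 * kF * jap k ^ 4 := by
  have hjap : jap k ^ 4 = (1 + znorm k ^ 2) ^ 2 := by
    rw [show 4 = 2 * 2 from rfl, pow_mul, jap, Real.sq_sqrt (by positivity)]
  by_cases hk : k = 0
  · rw [hk, Dsum_zero]
    exact mul_nonneg (by linarith) (pow_nonneg (Real.sqrt_nonneg _) _)
  obtain ⟨i, hi⟩ : ∃ i, k i ≠ 0 := Function.ne_iff.mp hk
  have hkF0 : 0 ≤ kF := by linarith
  have hnorm : |(k i : ℝ)| ≤ znorm k :=
    Real.abs_le_sqrt (Finset.single_le_sum (f := fun j => (k j : ℝ) ^ 2)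
      (fun _ _ => sq_nonneg _) (Finset.mem_univ i))
  have hnorm1 : 1 ≤ znorm k := by
    have : (1 : ℤ) ≤ |k i| := Int.one_le_abs hi
    have : (1 : ℝ) ≤ |(k i : ℝ)| := by exact_mod_cast this
    linarith
  set N : ℤ := ⌊znorm k * kF⌋ with hN
  have hN0 : 0 ≤ N := Int.floor_nonneg.mpr (by positivity)
  set I : Finset (ℤ × ℤ) := Finset.Icc (-N) N ×ˢ Finset.Ico 0 |k i| with hI
  have hcard : (I.card : ℝ) ≤ 3 * kF * znorm k ^ 2 := by
    have h1 : ((Finset.Icc (-N) N).card : ℝ) = 2 * N + 1 := by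
      have : ((Finset.Icc (-N) N).card : ℤ) = 2 * N + 1 := by
        rw [Int.card_Icc, Int.toNat_of_nonneg (by omega)]
        ring
      exact_mod_cast this
    have h2 : ((Finset.Ico 0 |k i|).card : ℝ) = |(k i : ℝ)| := by
      have : ((Finset.Ico 0 |k i|).card : ℤ) = |k i| := by
        rw [Int.card_Ico, sub_zero, Int.toNat_of_nonneg (abs_nonneg _)]
      exact_mod_cast this
    have h3 : (2 * N + 1 : ℝ) ≤ 3 * (znorm k * kF) := by
      have := Int.floor_le (znorm k * kF)
      nlinarith
    rw [hI, Finset.card_product, Nat.cast_mul, h1, h2]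
    calc (2 * N + 1 : ℝ) * |(k i : ℝ)| ≤ 3 * (znorm k * kF) * znorm k := by gcongr
      _ = 3 * kF * znorm k ^ 2 := by ring
  have hbound : (I.card : ℝ) * ((1 + znorm k ^ 2) * 6) ≤ 18 * kF * jap k ^ 4 := by
    rw [hjap]
    calc (I.card : ℝ) * ((1 + znorm k ^ 2) * 6)
        ≤ 3 * kF * znorm k ^ 2 * ((1 + znorm k ^ 2) * 6) := by gcongr
      _ ≤ 3 * kF * (1 + znorm k ^ 2) * ((1 + znorm k ^ 2) * 6) := by gcongr; linarith
      _ = 18 * kF * (1 + znorm k ^ 2) ^ 2 := by ring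
  refine le_trans ?_ hbound
  classical
  rw [Dsum]
  refine tsum_le_of_sum_le' (by positivity) fun S => ?_
  rw [← Finset.sum_filter, ← Finset.sum_fiberwise_of_maps_to (t := I)
    (g := fun p : Fin 3 → ℤ => (p (i + 2) * k i - p i * k (i + 2), p i % k i))]
  · rw [← nsmul_eq_mul]
    refine Finset.sum_le_card_nsmul _ _ _ fun wr _ => ?_
    refine sum_inv_gap_row_le hkF0 hi wr.1 wr.2 _ fun p hp => ?_
    simp only [Finset.mem_filter] at hp
    exact ⟨hp.1.2, congrArg Prod.fst hp.2, congrArg Prod.snd hp.2⟩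
  · intro p hp
    have hpl := (Finset.mem_filter.mp hp).2
    rw [hI, Finset.mem_product]
    refine ⟨?_, Finset.mem_Ico.mpr ⟨Int.emod_nonneg _ hi, Int.emod_lt_abs _ hi⟩⟩
    have hle := crossSq_le_of_mem_lune hkF0 hpl
    rw [crossSq_eq i] at hle
    have habs : |((p (i + 2) * k i - p i * k (i + 2) : ℤ) : ℝ)| ≤ znorm k * kF :=
      abs_le_of_sq_le_sq (by
        linarith [sq_nonneg ((p i : ℝ) * k (i + 1) - p (i + 1) * k i),
          sq_nonneg ((p (i + 1) : ℝ) * k (i + 2) - p (i + 2) * k (i + 1))]) (by positivity)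
    rw [← Int.cast_abs] at habs
    have := Int.le_floor.mpr habs
    exact Finset.mem_Icc.mpr (abs_le.mp this)

/-- There is `C > 0` such that for every `k_F ≥ 1`, every `β ≥ 0`,
and every `f : ℤ³ → [0, ∞]`,
`Σ_k f(k) ⟨k⟩^{2β} D₁(k, k_F) ≤ C k_F Σ_k f(k) ⟨k⟩^{2β + 4}`
(an inequality of extended nonnegative reals, trivially true if the right-hand side
is infinite). -/
theorem weighted_D1_sum_bound :
    ∃ C : ℝ, 0 < C ∧ ∀ kF : ℝ, 1 ≤ kF → ∀ β : ℝ, 0 ≤ β →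
      ∀ f : (Fin 3 → ℤ) → ℝ≥0∞,
      (∑' k : Fin 3 → ℤ,
          f k * ENNReal.ofReal ((jap k) ^ (2 * β)) * ENNReal.ofReal (Dsum 1 kF k))
        ≤ ENNReal.ofReal (C * kF) *
          ∑' k : Fin 3 → ℤ, f k * ENNReal.ofReal ((jap k) ^ (2 * β + 4)) := by
  refine ⟨18, by norm_num, fun kF hkF β _ f => ?_⟩
  rw [← ENNReal.tsum_mul_left]
  refine ENNReal.tsum_le_tsum fun k => ?_
  have hjap : 0 < jap k := Real.sqrt_pos.mpr (by positivity)
  rw [mul_assoc, mul_left_comm (ENNReal.ofReal _), ← ENNReal.ofReal_mul (by positivity),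
    ← ENNReal.ofReal_mul (by positivity)]
  gcongr f k * ENNReal.ofReal ?_
  rw [Real.rpow_add hjap, show (4 : ℝ) = (4 : ℕ) by norm_num, Real.rpow_natCast]
  calc jap k ^ (2 * β) * Dsum 1 kF k
      ≤ jap k ^ (2 * β) * (18 * kF * jap k ^ 4) := by
        gcongr
        exact Dsum_one_le hkF k
    _ = 18 * kF * (jap k ^ (2 * β) * jap k ^ 4) := by ring
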